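/- There are universal constants c, C > 0 such that the following holds. Fix η, γ' ∈ (0,1/2] and an integer k ≥ 1 with γ' ≤ η k^{−3/2}, and set γ̃ = γ'/(16k+2). Then there exist probability distributions P' and Q' on ℝ, both supported in the interval [−1/2, 1/2], such that: (i) the support of P' is contained in [γ̃, 1/2] and P'({γ̃}) ≥ 1 − Cη; (ii) Q'({−γ̃}) ≥ 1 − Cη; (iii) for every integer i ≥ 0, |E_{x∼P'}[x^i] − E_{x∼Q'}[x^i]| ≤ e^{−ck}. -/

import Mathlib

open MeasureTheory

lemma prod_sq_div_lt (j m : ℕ) (h : m < j) :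
    ∏ i ∈ (Finset.Icc 1 m).erase j, (i : ℝ) ^ 2 / |(j : ℝ) ^ 2 - i ^ 2| =
      (m.factorial : ℝ) ^ 2 * (j - m - 1).factorial * j / (j + m).factorial := by
  rw [Finset.erase_eq_of_notMem (by simp; omega)]
  induction m with
  | zero =>
    obtain ⟨t, rfl⟩ : ∃ t, j = t + 1 := ⟨j - 1, by omega⟩
    have := Nat.factorial_pos t
    simp [Nat.factorial_succ]
    field_simp
  | succ m ih =>
    obtain ⟨t, rfl⟩ : ∃ t, j = m + 1 + t + 1 := ⟨j - m - 2, by omega⟩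
    rw [Finset.prod_Icc_succ_top (by omega), ih (by omega)]
    have e1 : m + 1 + t + 1 - m - 1 = t + 1 := by omega
    have e2 : m + 1 + t + 1 - (m + 1) - 1 = t := by omega
    have e3 : m + 1 + t + 1 + (m + 1) = (m + 1 + t + 1 + m) + 1 := by omega
    rw [e1, e2, e3, Nat.factorial_succ, Nat.factorial_succ, Nat.factorial_succ (_ + m)]
    have e4 : |((m + 1 + t + 1 : ℕ) : ℝ) ^ 2 - ((m + 1 : ℕ) : ℝ) ^ 2| =
        (t + 1) * (2 * m + t + 3) := by
      rw [abs_of_nonneg] <;> push_cast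
      · ring
      · nlinarith [(Nat.cast_nonneg m : (0 : ℝ) ≤ m), (Nat.cast_nonneg t : (0 : ℝ) ≤ t)]
    rw [e4]
    have := Nat.factorial_pos (m + 1 + t + 1 + m)
    push_cast
    have h1 : (m : ℝ) + 1 + t + 1 + m + 1 = 2 * m + t + 3 := by ring
    rw [h1]
    field_simp

lemma prod_sq_div_ge (j t : ℕ) (h : 1 ≤ j) :
    ∏ i ∈ (Finset.Icc 1 (j + t)).erase j, (i : ℝ) ^ 2 / |(j : ℝ) ^ 2 - i ^ 2| =
      2 * ((j + t).factorial : ℝ) ^ 2 / (t.factorial * (2 * j + t).factorial) := by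
  induction t with
  | zero =>
    obtain ⟨u, rfl⟩ : ∃ u, j = u + 1 := ⟨j - 1, by omega⟩
    have e : (Finset.Icc 1 (u + 1 + 0)).erase (u + 1) = (Finset.Icc 1 u).erase (u + 1) := by
      ext; simp
    rw [e, prod_sq_div_lt _ _ (by omega)]
    have e1 : u + 1 - u - 1 = 0 := by omega
    have e2 : 2 * (u + 1) + 0 = (u + 1 + u) + 1 := by omega
    rw [e1, e2, add_zero, Nat.factorial_succ u, Nat.factorial_succ (_ + u)]
    have := Nat.factorial_pos (u + 1 + u)
    push_cast
    have h1 : (u : ℝ) + 1 + u + 1 = 2 * (u + 1) := by ring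
    rw [h1]
    field_simp
    simp
  | succ t ih =>
    have e : (Finset.Icc 1 (j + (t + 1))).erase j =
        insert (j + t + 1) ((Finset.Icc 1 (j + t)).erase j) := by
      ext; simp; omega
    rw [e, Finset.prod_insert (by simp), ih, ← add_assoc, ← add_assoc, Nat.factorial_succ,
      Nat.factorial_succ, Nat.factorial_succ]
    have e4 : |(j : ℝ) ^ 2 - ((j + t + 1 : ℕ) : ℝ) ^ 2| = (t + 1) * (2 * j + t + 1) := by
      rw [abs_of_nonpos] <;> push_cast
      · ring
      · nlinarith [(Nat.cast_nonneg j : (0 : ℝ) ≤ j), (Nat.cast_nonneg t : (0 : ℝ) ≤ t)]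
    rw [e4]
    have := Nat.factorial_pos (2 * j + t)
    push_cast
    field_simp

lemma factorial_sq_le (j t : ℕ) :
    (j + t).factorial ^ 2 ≤ t.factorial * (2 * j + t).factorial := by
  induction j with
  | zero => simp [sq]
  | succ j ih =>
    have e : 2 * (j + 1) + t = 2 * j + t + 1 + 1 := by ring
    have e' : j + 1 + t = j + t + 1 := by ring
    rw [e, e', Nat.factorial_succ, Nat.factorial_succ, Nat.factorial_succ, mul_pow]
    calc (j + t + 1) ^ 2 * (j + t).factorial ^ 2
        ≤ ((2 * j + t + 1 + 1) * (2 * j + t + 1)) * (t.factorial * (2 * j + t).factorial) := by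
          gcongr
          nlinarith
      _ = _ := by ring

lemma prod_sq_div_le_two {j n : ℕ} (h : 1 ≤ j) (hn : j ≤ n) :
    ∏ i ∈ (Finset.Icc 1 n).erase j, (i : ℝ) ^ 2 / |(j : ℝ) ^ 2 - i ^ 2| ≤ 2 := by
  obtain ⟨t, rfl⟩ := Nat.exists_eq_add_of_le hn
  rw [prod_sq_div_ge j t h]
  rw [div_le_iff₀ (by positivity)]
  have := factorial_sq_le j t
  have : ((j + t).factorial : ℝ) ^ 2 ≤ t.factorial * (2 * j + t).factorial := by exact_mod_cast this
  linarith

lemma sum_inv_sq_le_two (n : ℕ) : ∑ i ∈ Finset.Icc 1 n, ((i : ℝ) ^ 2)⁻¹ ≤ 2 := by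
  have := sum_Ioo_inv_sq_le (α := ℝ) 0 (n + 1)
  have e : Finset.Ioo 0 (n + 1) = Finset.Icc 1 n := by ext; simp; omega
  rw [e] at this
  simpa using this

lemma exists_discrete_measure {ι : Type*} (s : Finset ι) (w x : ι → ℝ)
    (hw : ∀ j ∈ s, 0 ≤ w j) (hs : ∑ j ∈ s, w j = 1) :
    ∃ μ : Measure ℝ, IsProbabilityMeasure μ ∧
      (∀ S : Set ℝ, MeasurableSet S → (∀ j ∈ s, x j ∈ S) → μ Sᶜ = 0) ∧
      (∀ j ∈ s, w j ≤ (μ {x j}).toReal) ∧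
      ∀ f : ℝ → ℝ, ∫ y, f y ∂μ = ∑ j ∈ s, w j * f (x j) := by
  let μ : Measure ℝ := ∑ j ∈ s, ENNReal.ofReal (w j) • Measure.dirac (x j)
  have hμ : IsProbabilityMeasure μ := by
    constructor
    simp only [μ, Measure.coe_finsetSum, Finset.sum_apply, Measure.smul_apply, measure_univ,
      smul_eq_mul, mul_one]
    rw [← ENNReal.ofReal_sum_of_nonneg hw, hs, ENNReal.ofReal_one]
  refine ⟨μ, hμ, ?_, ?_, ?_⟩
  · intro S hS hx
    simp only [μ, Measure.coe_finsetSum, Finset.sum_apply, Measure.smul_apply, smul_eq_mul]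
    refine Finset.sum_eq_zero fun j hj => ?_
    simp [Measure.dirac_apply' _ hS.compl, hx j hj]
  · intro j hj
    rw [← ENNReal.ofReal_le_iff_le_toReal (measure_ne_top _ _)]
    simp only [μ, Measure.coe_finsetSum, Finset.sum_apply, Measure.smul_apply, smul_eq_mul]
    refine le_trans ?_ (Finset.single_le_sum
      (f := fun i => ENNReal.ofReal (w i) * Measure.dirac (x i) {x j}) (fun _ _ => zero_le) hj)
    simp
  · intro f
    rw [integral_finsetSum_measure fun j _ =>
      (integrable_dirac (by simp)).smul_measure ENNReal.ofReal_ne_top]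
    refine Finset.sum_congr rfl fun j hj => ?_
    rw [integral_smul_measure, integral_dirac, ENNReal.toReal_ofReal (hw j hj), smul_eq_mul]

lemma exists_extrapolation_weights {n : ℕ} (hn : 1 ≤ n) {g : ℝ} (hg : 0 < g)
    (hgn : 16 * g * n ^ 2 ≤ 1) :
    ∃ a : ℕ → ℝ, (∀ i ≤ n, ∑ j ∈ Finset.range (n + 1),
        a j * (g + (j : ℝ) ^ 2 / (4 * n ^ 2)) ^ i = (-g) ^ i) ∧
      ∑ j ∈ Finset.Icc 1 n, |a j| ≤ 96 * g * n ^ 2 := by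
  have hn0 : (0 : ℝ) < n := by exact_mod_cast hn
  let x : ℕ → ℝ := fun j => g + (j : ℝ) ^ 2 / (4 * n ^ 2)
  have hx : Function.Injective x := by
    intro i j hij
    simp only [x] at hij
    field_simp at hij
    have : (i : ℝ) ^ 2 = (j : ℝ) ^ 2 := by linarith
    exact_mod_cast (pow_left_inj₀ (by positivity) (by positivity) two_ne_zero).1 this
  refine ⟨fun j => (Lagrange.basis (Finset.range (n + 1)) x j).eval (-g), ?_, ?_⟩
  · intro i hi
    have := Lagrange.eq_interpolate (s := Finset.range (n + 1)) (v := x)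
      (f := (Polynomial.X ^ i : Polynomial ℝ)) hx.injOn (by
        rw [Polynomial.degree_X_pow, Finset.card_range]; exact_mod_cast Nat.lt_succ_of_le hi)
    have := congrArg (Polynomial.eval (-g)) this
    rw [Lagrange.interpolate_apply, Polynomial.eval_finsetSum] at this
    simp only [Polynomial.eval_mul, Polynomial.eval_C, Polynomial.eval_pow,
      Polynomial.eval_X] at this
    rw [this]
    exact Finset.sum_congr rfl fun j _ => mul_comm _ _
  · have key : ∀ j ∈ Finset.Icc 1 n,
        |(Lagrange.basis (Finset.range (n + 1)) x j).eval (-g)| ≤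
          48 * g * n ^ 2 * ((j : ℝ) ^ 2)⁻¹ := by
      intro j hj
      rw [Finset.mem_Icc] at hj
      have hj0 : (0 : ℝ) < j := by exact_mod_cast hj.1
      have e : (Finset.range (n + 1)).erase j = insert 0 ((Finset.Icc 1 n).erase j) := by
        ext; simp; omega
      rw [Lagrange.basis, Polynomial.eval_prod, e, Finset.prod_insert (by simp),
        abs_mul, Finset.abs_prod]
      have h0 : |(Lagrange.basisDivisor (x j) (x 0)).eval (-g)| =
          8 * g * n ^ 2 * ((j : ℝ) ^ 2)⁻¹ := by
        have : (Lagrange.basisDivisor (x j) (x 0)).eval (-g) =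
            -(8 * g * n ^ 2 * ((j : ℝ) ^ 2)⁻¹) := by
          simp [Lagrange.basisDivisor, x]
          field_simp
          ring
        rw [this, abs_neg, abs_of_nonneg (by positivity)]
      have h1 : ∀ i ∈ (Finset.Icc 1 n).erase j,
          |(Lagrange.basisDivisor (x j) (x i)).eval (-g)| =
          (i : ℝ) ^ 2 / |(j : ℝ) ^ 2 - i ^ 2| * (1 + 8 * g * n ^ 2 * ((i : ℝ) ^ 2)⁻¹) := by
        intro i hi
        rw [Finset.mem_erase, Finset.mem_Icc] at hi
        have hi0 : (0 : ℝ) < i := by exact_mod_cast hi.2.1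
        have hne : (j : ℝ) ^ 2 - i ^ 2 ≠ 0 := fun h =>
          hi.1 (by exact_mod_cast
            (pow_left_inj₀ hi0.le hj0.le two_ne_zero).1 (sub_eq_zero.1 h).symm)
        have h2 : (Lagrange.basisDivisor (x j) (x i)).eval (-g) =
            -((i : ℝ) ^ 2 + 8 * g * n ^ 2) / ((j : ℝ) ^ 2 - i ^ 2) := by
          have : x j - x i = ((j : ℝ) ^ 2 - i ^ 2) / (4 * n ^ 2) := by simp only [x]; ring
          rw [Lagrange.basisDivisor]
          simp only [Polynomial.eval_mul, Polynomial.eval_C, Polynomial.eval_sub,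
            Polynomial.eval_X, this, x]
          field_simp
          ring
        rw [h2, abs_div, abs_neg, abs_of_nonneg (by positivity)]
        have := abs_pos.2 hne
        field_simp
      rw [h0, Finset.prod_congr rfl h1, Finset.prod_mul_distrib]
      have h3 : ∏ i ∈ (Finset.Icc 1 n).erase j, (1 + 8 * g * n ^ 2 * ((i : ℝ) ^ 2)⁻¹) ≤ 3 := by
        calc _ ≤ ∏ i ∈ (Finset.Icc 1 n).erase j, Real.exp (8 * g * n ^ 2 * ((i : ℝ) ^ 2)⁻¹) := by
              refine Finset.prod_le_prod (fun i _ => by positivity) fun i _ => ?_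
              rw [add_comm]
              exact Real.add_one_le_exp _
          _ = Real.exp (8 * g * n ^ 2 * ∑ i ∈ (Finset.Icc 1 n).erase j, ((i : ℝ) ^ 2)⁻¹) := by
              rw [← Real.exp_sum, Finset.mul_sum]
          _ ≤ Real.exp 1 := by
              apply Real.exp_le_exp.2
              have : ∑ i ∈ (Finset.Icc 1 n).erase j, ((i : ℝ) ^ 2)⁻¹ ≤ 2 :=
                (Finset.sum_le_sum_of_subset_of_nonneg (Finset.erase_subset _ _)
                  fun _ _ _ => by positivity).trans (sum_inv_sq_le_two n)
              calc _ ≤ 8 * g * n ^ 2 * 2 := by gcongr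
                _ ≤ 1 := by linarith
          _ ≤ 3 := by linarith [Real.exp_one_lt_d9]
      calc _ ≤ 8 * g * n ^ 2 * ((j : ℝ) ^ 2)⁻¹ * (2 * 3) := by
            gcongr
            exact prod_sq_div_le_two hj.1 hj.2
        _ = _ := by ring
    refine (Finset.sum_le_sum key).trans ?_
    rw [← Finset.mul_sum]
    calc _ ≤ 48 * g * n ^ 2 * 2 := by gcongr; exact sum_inv_sq_le_two n
      _ = _ := by ring

lemma abs_integral_pow_le (μ : Measure ℝ) [IsProbabilityMeasure μ]
    (h : μ (Set.Icc (-(1 : ℝ) / 2) (1 / 2))ᶜ = 0) (i : ℕ) :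
    |∫ x, x ^ i ∂μ| ≤ (1 / 2) ^ i := by
  have := norm_integral_le_of_norm_le_const (μ := μ) (f := fun x : ℝ => x ^ i)
    (C := (1 / 2) ^ i) (by
      have : ∀ᵐ x ∂μ, x ∈ Set.Icc (-(1 : ℝ) / 2) (1 / 2) := h
      filter_upwards [this] with x hx
      rw [norm_pow, Real.norm_eq_abs]
      gcongr
      rw [abs_le]
      constructor <;> linarith [hx.1, hx.2])
  simpa using this

/-- Splitting the extrapolation weights into positive and negative parts produces two probability
measures, one with most of its mass at `g` and one with most of its mass at `-g`, whose first `n`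
moments agree. -/
lemma exists_measures_of_weights {n : ℕ} {g A : ℝ} (hg : 0 < g) {a x : ℕ → ℝ} (hx0 : x 0 = g)
    (hx : ∀ j ∈ Finset.range (n + 1), x j ∈ Set.Icc g (1 / 2))
    (ha : ∀ i ≤ n, ∑ j ∈ Finset.range (n + 1), a j * x j ^ i = (-g) ^ i)
    (hA : ∑ j ∈ Finset.Icc 1 n, |a j| ≤ A) :
    ∃ P Q : Measure ℝ, IsProbabilityMeasure P ∧ IsProbabilityMeasure Q ∧
      P (Set.Icc g (1 / 2))ᶜ = 0 ∧ Q (Set.Icc (-(1 : ℝ) / 2) (1 / 2))ᶜ = 0 ∧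
      1 - 2 * A ≤ (P {g}).toReal ∧ 1 - 2 * A ≤ (Q {-g}).toReal ∧
      ∀ i ≤ n, ∫ y, y ^ i ∂P = ∫ y, y ^ i ∂Q := by
  set s := Finset.range (n + 1) with hs
  have h0s : 0 ∈ s := by simp [s]
  have hg2 : g ≤ 1 / 2 := by have := hx 0 h0s; rw [hx0] at this; exact this.2
  have hA0 : 0 ≤ A := (Finset.sum_nonneg fun _ _ => abs_nonneg _).trans hA
  have hsplit : ∀ f : ℕ → ℝ, ∑ j ∈ s, f j = f 0 + ∑ j ∈ Finset.Icc 1 n, f j := by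
    intro f
    have e : s = insert 0 (Finset.Icc 1 n) := by ext; simp [s]; omega
    rw [e, Finset.sum_insert (by simp)]
  have hsum : ∑ j ∈ s, a j = 1 := by simpa using ha 0 (Nat.zero_le _)
  set Z := 1 + ∑ j ∈ s, (a j)⁻ with hZ
  have hZ1 : 1 ≤ Z := by
    have : 0 ≤ ∑ j ∈ s, (a j)⁻ := Finset.sum_nonneg fun j _ => negPart_nonneg _
    linarith
  have hpos : ∑ j ∈ s, (a j)⁺ = Z := by
    rw [hZ, ← hsum, ← Finset.sum_add_distrib]
    exact Finset.sum_congr rfl fun j _ => by linarith [posPart_sub_negPart (a j)]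
  have hZ0 : 0 < Z := by linarith
  have hPA : ∑ j ∈ Finset.Icc 1 n, (a j)⁺ ≤ A :=
    (Finset.sum_le_sum fun j _ => by
      linarith [posPart_add_negPart (a j), negPart_nonneg (a j)]).trans hA
  have hNA : ∑ j ∈ Finset.Icc 1 n, (a j)⁻ ≤ A :=
    (Finset.sum_le_sum fun j _ => by
      linarith [posPart_add_negPart (a j), posPart_nonneg (a j)]).trans hA
  have hp0 : Z - A ≤ (a 0)⁺ := by
    have := hsplit fun j => (a j)⁺
    linarith
  have hZA : Z ≤ 1 + 2 * A := by
    have h1 := hsplit fun j => (a j)⁻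
    have h2 := hsplit a
    have h3 : ∑ j ∈ Finset.Icc 1 n, a j ≤ A :=
      (Finset.sum_le_sum fun j _ => le_abs_self _).trans hA
    have h4 : (a 0)⁻ ≤ A := by
      rw [negPart_def]
      exact sup_le (by linarith) hA0
    linarith
  obtain ⟨P, hP, hPs, hPm, hPi⟩ := exists_discrete_measure s (fun j => (a j)⁺ / Z) x
    (fun j _ => div_nonneg (posPart_nonneg _) hZ0.le)
    (by rw [← Finset.sum_div, hpos, div_self hZ0.ne'])
  obtain ⟨Q, hQ, hQs, hQm, hQi⟩ := exists_discrete_measure (Finset.insertNone s)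
    (fun o => o.elim 1 (fun j => (a j)⁻) / Z) (fun o => o.elim (-g) x)
    (by
      rintro (_ | j) _
      · simpa using hZ0.le
      · exact div_nonneg (negPart_nonneg _) hZ0.le)
    (by rw [← Finset.sum_div, Finset.sum_insertNone]; exact div_self hZ0.ne')
  refine ⟨P, Q, hP, hQ, hPs _ measurableSet_Icc hx, hQs _ measurableSet_Icc ?_, ?_, ?_, ?_⟩
  · rintro (_ | j) hj
    · constructor <;> simp only [Option.elim] <;> linarith
    · have := hx j (by simpa using hj)
      constructor <;> simp only [Option.elim] <;> linarith [this.1, this.2]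
  · have := hPm 0 h0s
    rw [hx0] at this
    refine le_trans ?_ this
    rw [le_div_iff₀ hZ0]
    nlinarith
  · refine le_trans ?_ (hQm none (by simp))
    simp only [Option.elim]
    rw [le_div_iff₀ hZ0]
    nlinarith
  · intro i hi
    rw [hPi, hQi, Finset.sum_insertNone]
    simp only [Option.elim]
    rw [← ha i hi, Finset.sum_congr rfl fun j _ => show (a j)⁺ / Z * x j ^ i =
      1 / Z * (a j * x j ^ i) + (a j)⁻ / Z * x j ^ i by
        rw [← sub_eq_iff_eq_add, ← sub_mul, ← sub_div, posPart_sub_negPart]; ring,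
      Finset.sum_add_distrib, Finset.mul_sum]


/-- There are universal constants `c, C > 0` such that for all `η, γ' ∈ (0,1/2]` and
integers `k ≥ 1` with `γ' ≤ η k^{-3/2}`, setting `γ̃ = γ'/(16k+2)`, there exist
probability distributions `P'` and `Q'` on `ℝ`, both supported in `[-1/2, 1/2]`,
such that: (i) the support of `P'` is contained in `[γ̃, 1/2]` and `P'({γ̃}) ≥ 1 - Cη`;
(ii) `Q'({-γ̃}) ≥ 1 - Cη`; (iii) for every integer `i ≥ 0`,
`|E_{P'}[x^i] - E_{Q'}[x^i]| ≤ e^{-ck}`. -/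
theorem rescaled_moment_matching :
    ∃ c C : ℝ, 0 < c ∧ 0 < C ∧
      ∀ (η γ' : ℝ) (k : ℕ), 0 < η → η ≤ 1 / 2 → 0 < γ' → γ' ≤ 1 / 2 → 1 ≤ k →
        γ' ≤ η * (k : ℝ) ^ (-(3 : ℝ) / 2) →
        ∃ P' Q' : Measure ℝ, IsProbabilityMeasure P' ∧ IsProbabilityMeasure Q' ∧
          P' (Set.Icc (-(1 : ℝ) / 2) (1 / 2))ᶜ = 0 ∧
          Q' (Set.Icc (-(1 : ℝ) / 2) (1 / 2))ᶜ = 0 ∧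
          P' (Set.Icc (γ' / (16 * k + 2)) (1 / 2))ᶜ = 0 ∧
          1 - C * η ≤ (P' {γ' / (16 * k + 2)}).toReal ∧
          1 - C * η ≤ (Q' {-(γ' / (16 * k + 2))}).toReal ∧
          ∀ i : ℕ, |(∫ x, x ^ i ∂P') - ∫ x, x ^ i ∂Q'| ≤ Real.exp (-c * k) := by
  refine ⟨Real.log 2, 12, Real.log_pos one_lt_two, by norm_num, ?_⟩
  intro η γ' k hη hη2 hγ hγ2 hk hγk
  have hk1 : (1 : ℝ) ≤ k := by exact_mod_cast hk
  have hk0 : (0 : ℝ) < k := by linarith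
  set g := γ' / (16 * k + 2) with hg
  have hg0 : 0 < g := by positivity
  have hgk : 16 * g * k ^ 2 ≤ η := by
    have h1 : g * (16 * k) ≤ γ' := by
      rw [hg, div_mul_eq_mul_div, div_le_iff₀ (by positivity)]
      nlinarith
    have h2 : (k : ℝ) ^ (-(3 : ℝ) / 2) ≤ (k : ℝ) ^ (-1 : ℝ) :=
      Real.rpow_le_rpow_of_exponent_le hk1 (by norm_num)
    rw [Real.rpow_neg_one] at h2
    calc 16 * g * k ^ 2 = g * (16 * k) * k := by ring
      _ ≤ γ' * k := by gcongr
      _ ≤ η * (k : ℝ)⁻¹ * k := by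
          gcongr
          exact hγk.trans (by gcongr)
      _ = η := by field_simp
  have hg4 : g ≤ 1 / 4 := by nlinarith
  obtain ⟨a, ha, hA⟩ := exists_extrapolation_weights hk hg0 (by linarith)
  obtain ⟨P, Q, hP, hQ, hPs, hQs, hPm, hQm, hi⟩ := exists_measures_of_weights
    (x := fun j => g + (j : ℝ) ^ 2 / (4 * k ^ 2)) hg0 (by simp) (fun j hj => by
      have hj : (j : ℝ) ≤ k := by
        exact_mod_cast Nat.lt_succ_iff.1 (Finset.mem_range.1 hj)
      have h1 : (j : ℝ) ^ 2 / (4 * k ^ 2) ≤ 1 / 4 := by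
        rw [div_le_iff₀ (by positivity)]
        nlinarith [(Nat.cast_nonneg j : (0 : ℝ) ≤ j)]
      have h2 : 0 ≤ (j : ℝ) ^ 2 / (4 * k ^ 2) := by positivity
      constructor <;> linarith) ha hA
  have hPs' : P (Set.Icc (-(1 : ℝ) / 2) (1 / 2))ᶜ = 0 :=
    measure_mono_null (Set.compl_subset_compl.2 (Set.Icc_subset_Icc_left (by linarith))) hPs
  refine ⟨P, Q, hP, hQ, hPs', hQs, hPs, by linarith, by linarith, fun i => ?_⟩
  rcases le_or_gt i k with h | h
  · rw [hi i h, sub_self, abs_zero]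
    positivity
  · have hexp : Real.exp (-Real.log 2 * k) = (1 / 2) ^ k := by
      rw [mul_comm, Real.exp_nat_mul, Real.exp_neg, Real.exp_log two_pos, one_div]
    rw [hexp]
    calc _ ≤ |∫ x, x ^ i ∂P| + |∫ x, x ^ i ∂Q| := abs_sub _ _
      _ ≤ (1 / 2) ^ i + (1 / 2) ^ i :=
          add_le_add (abs_integral_pow_le P hPs' i) (abs_integral_pow_le Q hQs i)
      _ ≤ (1 / 2) ^ (k + 1) + (1 / 2) ^ (k + 1) := by
          gcongr ?_ + ?_ <;> exact pow_le_pow_of_le_one (by norm_num) (by norm_num) h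
      _ = (1 / 2) ^ k := by ring
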